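/- Assume there exists a μx-integrable function g : ℝ^{d_x} → ℝ₊ such that ‖T(u,x)‖₂ ≤ g(x)(1 + ‖u‖₂) for all u ∈ ℝ^{d_u} and x ∈ ℝ^{d_x}. Define κ(u, (X,Y,θ)) := 2nL(L + ‖T(u,X)‖_{∞,2} + ‖Y‖_{∞,2}). Then there exists a constant c ≥ 0 such that for every u ∈ ℝ^{d_u}, ∫ κ(u, z) d(μx^{⊗n} ⊗ μy^{⊗n} ⊗ σ)(z) ≤ c·(1 + ‖u‖₂). -/

import Mathlib

open scoped BigOperators
open MeasureTheory

/-- `‖A‖_{∞,2}`: the maximum of the euclidean norms of the components of a tuple. -/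
noncomputable def normInf2 {d n : ℕ} (A : Fin n → EuclideanSpace ℝ (Fin d)) : ℝ :=
  ⨆ k, ‖A k‖

/-- The uniform (normalized) probability measure on the unit sphere of `ℝ^d`. -/
noncomputable def sphereUniform (d : ℕ) :
    Measure (Metric.sphere (0 : EuclideanSpace ℝ (Fin d)) 1) :=
  ((volume : Measure (EuclideanSpace ℝ (Fin d))).toSphere Set.univ)⁻¹ •
    (volume : Measure (EuclideanSpace ℝ (Fin d))).toSphere

lemma sphereUniform_finite {d : ℕ} (hd : 1 ≤ d) : IsFiniteMeasure (sphereUniform d) := by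
  unfold sphereUniform
  apply Measure.smul_finite
  rw [Ne, ENNReal.inv_eq_top, Measure.toSphere_apply_univ, mul_eq_zero, not_or]
  constructor
  · simp; omega
  · exact (Metric.measure_ball_pos volume _ one_pos).ne'

lemma normInf2_nonneg {d n : ℕ} (A : Fin n → EuclideanSpace ℝ (Fin d)) : 0 ≤ normInf2 A :=
  Real.iSup_nonneg fun _ => norm_nonneg _

lemma normInf2_le_sum {d n : ℕ} (A : Fin n → EuclideanSpace ℝ (Fin d)) :
    normInf2 A ≤ ∑ k, ‖A k‖ :=
  Real.iSup_le (fun k => Finset.single_le_sum (f := fun k => ‖A k‖)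
    (fun _ _ => norm_nonneg _) (Finset.mem_univ k))
    (Finset.sum_nonneg fun _ _ => norm_nonneg _)

theorem stmt11 {du dx dy n : ℕ} (hn : 1 ≤ n) (hdy : 1 ≤ dy)
    (T : EuclideanSpace ℝ (Fin du) → EuclideanSpace ℝ (Fin dx) → EuclideanSpace ℝ (Fin dy))
    (L : ℝ) (hL : 0 < L)
    (hT : ∀ (u₁ u₂ : EuclideanSpace ℝ (Fin du)) (x₁ x₂ : EuclideanSpace ℝ (Fin dx)),
      ‖T u₁ x₁ - T u₂ x₂‖ ≤ L * (‖u₁ - u₂‖ + ‖x₁ - x₂‖))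
    (μx : Measure (EuclideanSpace ℝ (Fin dx))) (μy : Measure (EuclideanSpace ℝ (Fin dy)))
    [IsProbabilityMeasure μx] [IsProbabilityMeasure μy]
    (𝒳 : Set (EuclideanSpace ℝ (Fin dx))) (𝒴 : Set (EuclideanSpace ℝ (Fin dy)))
    (h𝒳 : IsCompact 𝒳) (h𝒴 : IsCompact 𝒴)
    (hμx : μx 𝒳ᶜ = 0) (hμy : μy 𝒴ᶜ = 0)
    (g : EuclideanSpace ℝ (Fin dx) → ℝ) (hg0 : ∀ x, 0 ≤ g x)
    (hgint : Integrable g μx)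
    (hgT : ∀ (u : EuclideanSpace ℝ (Fin du)) (x : EuclideanSpace ℝ (Fin dx)),
      ‖T u x‖ ≤ g x * (1 + ‖u‖)) :
    ∃ c : ℝ, 0 ≤ c ∧ ∀ u : EuclideanSpace ℝ (Fin du),
      (∫ z : (Fin n → EuclideanSpace ℝ (Fin dx)) × (Fin n → EuclideanSpace ℝ (Fin dy)) ×
          Metric.sphere (0 : EuclideanSpace ℝ (Fin dy)) 1,
        2 * n * L * (L + normInf2 (fun k => T u (z.1 k)) + normInf2 z.2.1)
        ∂((Measure.pi fun _ : Fin n => μx).prod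
            ((Measure.pi fun _ : Fin n => μy).prod (sphereUniform dy)))) ≤
      c * (1 + ‖u‖) := by
  have := sphereUniform_finite hdy
  have hyint : Integrable (fun y : EuclideanSpace ℝ (Fin dy) => ‖y‖) μy := by
    obtain ⟨B, hB⟩ := h𝒴.isBounded.exists_norm_le
    refine Integrable.of_bound (by fun_prop) B ?_
    have : ∀ᵐ y ∂μy, y ∈ 𝒴 := hμy
    filter_upwards [this] with y hy
    simpa using hB y hy
  let F : (Fin n → EuclideanSpace ℝ (Fin dx)) × (Fin n → EuclideanSpace ℝ (Fin dy)) ×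
          Metric.sphere (0 : EuclideanSpace ℝ (Fin dy)) 1 → ℝ := fun z =>
    2 * n * L * (L + ∑ k, g (z.1 k) + ∑ k, ‖z.2.1 k‖)
  have hF0 : ∀ z, 0 ≤ F z := fun z => by
    have h1 : 0 ≤ ∑ k, g (z.1 k) := Finset.sum_nonneg fun _ _ => hg0 _
    have h2 : 0 ≤ ∑ k, ‖z.2.1 k‖ := Finset.sum_nonneg fun _ _ => norm_nonneg _
    positivity
  have hFint : Integrable F ((Measure.pi fun _ : Fin n => μx).prod
            ((Measure.pi fun _ : Fin n => μy).prod (sphereUniform dy))) := by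
    refine Integrable.const_mul (((integrable_const L).add ?_).add ?_) _
    · refine Integrable.comp_fst (f := fun x : Fin n → EuclideanSpace ℝ (Fin dx) => ∑ k, g (x k)) ?_ _
      exact integrable_finsetSum _ fun k _ =>
        (measurePreserving_eval (fun _ : Fin n => μx) k).integrable_comp_of_integrable hgint
    · refine Integrable.comp_snd (f := fun w : (Fin n → EuclideanSpace ℝ (Fin dy)) ×
          Metric.sphere (0 : EuclideanSpace ℝ (Fin dy)) 1 => ∑ k, ‖w.1 k‖) ?_ _
      refine Integrable.comp_fst (f := fun x : Fin n → EuclideanSpace ℝ (Fin dy) => ∑ k, ‖x k‖) ?_ _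
      exact integrable_finsetSum _ fun k _ =>
        (measurePreserving_eval (fun _ : Fin n => μy) k).integrable_comp_of_integrable hyint
  refine ⟨∫ z, F z ∂((Measure.pi fun _ : Fin n => μx).prod
            ((Measure.pi fun _ : Fin n => μy).prod (sphereUniform dy))), integral_nonneg hF0, fun u => ?_⟩
  rw [← integral_mul_const]
  refine integral_mono_of_nonneg (.of_forall fun z => ?_) (hFint.mul_const _) (.of_forall fun z => ?_)
  · have h1 := normInf2_nonneg (fun k => T u (z.1 k))
    have h2 := normInf2_nonneg z.2.1
    simp only [Pi.zero_apply]
    positivity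
  · have h1 : normInf2 (fun k => T u (z.1 k)) ≤ (∑ k, g (z.1 k)) * (1 + ‖u‖) := by
      rw [Finset.sum_mul]
      exact (normInf2_le_sum _).trans (Finset.sum_le_sum fun k _ => hgT u _)
    have h2 := normInf2_le_sum z.2.1
    have h3 : 0 ≤ ∑ k, ‖z.2.1 k‖ := Finset.sum_nonneg fun _ _ => norm_nonneg _
    have h4 := norm_nonneg u
    simp only [F]
    rw [mul_assoc (2 * (n:ℝ) * L)]
    refine mul_le_mul_of_nonneg_left ?_ (by positivity)
    nlinarith [mul_nonneg h3 h4, mul_nonneg hL.le h4]
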